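/- Let M be a planar hypermap and let (x, b) be a single-element ring of faces in M (a ring of length 1). Let M' be obtained from M by breaking the 0-link at x. Then the number of connected components satisfies nc(M') = nc(M) + 1. -/

import Mathlib

open scoped Classical

/-- Dimensions 0 and 1. -/
inductive Dim : Type
  | zero : Dim
  | one : Dim
deriving DecidableEq

/-- Free maps: empty map, dart insertion, dart linking at a dimension. -/
inductive Fmap : Type
  | V : Fmap
  | I : Fmap → Nat → Fmap
  | L : Fmap → Dim → Nat → Nat → Fmap

namespace Fmap

/-- The nil (exception) dart. -/
def nil : Nat := 0

/-- A dart exists in the map. -/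
def exd : Fmap → Nat → Prop
  | V, _ => False
  | I m0 x, z => z = x ∨ exd m0 z
  | L m0 _ _ _, z => exd m0 z

/-- The (partial) k-successor α_k, with nil for undefined. -/
def A : Fmap → Dim → Nat → Nat
  | V, _, _ => nil
  | I m0 _, k, z => A m0 k z
  | L m0 k0 x y, k, z =>
      if k = k0 then (if z = x then y else A m0 k z) else A m0 k z

/-- The (partial) k-predecessor. -/
def A_1 : Fmap → Dim → Nat → Nat
  | V, _, _ => nil
  | I m0 _, k, z => A_1 m0 k z
  | L m0 k0 x y, k, z =>
      if k = k0 then (if z = y then x else A_1 m0 k z) else A_1 m0 k z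

/-- z has a k-successor. -/
def succd (m : Fmap) (k : Dim) (z : Nat) : Prop := A m k z ≠ nil

/-- z has a k-predecessor. -/
def predd (m : Fmap) (k : Dim) (z : Nat) : Prop := A_1 m k z ≠ nil

/-- Bottom dart of the open k-orbit of z. -/
def bottom : Fmap → Dim → Nat → Nat
  | V, _, _ => nil
  | I m0 x, k, z => if z = x then z else bottom m0 k z
  | L m0 k0 x y, k, z =>
      if k = k0 then
        (if bottom m0 k z = y then bottom m0 k x else bottom m0 k z)
      else bottom m0 k z

/-- Top dart of the open k-orbit of z. -/
def top : Fmap → Dim → Nat → Nat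
  | V, _, _ => nil
  | I m0 x, k, z => if z = x then z else top m0 k z
  | L m0 k0 x y, k, z =>
      if k = k0 then
        (if top m0 k z = x then top m0 k y else top m0 k z)
      else top m0 k z

/-- Closure of A: a permutation of existing darts. -/
def cA : Fmap → Dim → Nat → Nat
  | V, _, _ => nil
  | I m0 x, k, z => if z = x then z else cA m0 k z
  | L m0 k0 x y, k, z =>
      if k = k0 then
        (if z = x then y
         else if z = top m0 k y then bottom m0 k x
         else cA m0 k z)
      else cA m0 k z

/-- Closure of A_1: the inverse permutation of cA. -/
def cA_1 : Fmap → Dim → Nat → Nat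
  | V, _, _ => nil
  | I m0 x, k, z => if z = x then z else cA_1 m0 k z
  | L m0 k0 x y, k, z =>
      if k = k0 then
        (if z = y then x
         else if z = bottom m0 k x then top m0 k y
         else cA_1 m0 k z)
      else cA_1 m0 k z

/-- Precondition for inserting a dart. -/
def prec_I (m : Fmap) (x : Nat) : Prop := x ≠ nil ∧ ¬ exd m x

/-- Precondition for linking two darts at a dimension (keeping orbits open). -/
def prec_L (m : Fmap) (k : Dim) (x y : Nat) : Prop :=
  exd m x ∧ exd m y ∧ ¬ succd m k x ∧ ¬ predd m k y ∧ cA m k x ≠ y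

/-- The hypermap invariant. -/
def inv_hmap : Fmap → Prop
  | V => True
  | I m0 x => inv_hmap m0 ∧ prec_I m0 x
  | L m0 k0 x y => inv_hmap m0 ∧ prec_L m0 k0 x y

/-- The closed face map cF, corresponding to φ = α₁⁻¹ ∘ α₀⁻¹. -/
def cF (m : Fmap) (z : Nat) : Nat := cA_1 m Dim.one (cA_1 m Dim.zero z)

/-- Two darts are in the same face (existence of a cF-path). -/
def expf (m : Fmap) (z t : Nat) : Prop := exd m z ∧ ∃ n : ℕ, (cF m)^[n] z = t

/-- Two darts are in the same edge (existence of a (cA zero)-path). -/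
def expe (m : Fmap) (z t : Nat) : Prop := exd m z ∧ ∃ n : ℕ, (fun w => cA m Dim.zero w)^[n] z = t

/-- Two darts are in the same connected component. -/
def eqc : Fmap → Nat → Nat → Prop
  | V, _, _ => False
  | I m0 x, z, t => (z = x ∧ t = x) ∨ eqc m0 z t
  | L m0 _ x y, z, t =>
      eqc m0 z t ∨ (eqc m0 z x ∧ eqc m0 y t) ∨ (eqc m0 z y ∧ eqc m0 x t)

/-- Number of darts. -/
def nd : Fmap → ℤ
  | V => 0
  | I m0 _ => nd m0 + 1
  | L m0 _ _ _ => nd m0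

/-- Number of vertices. -/
def nv : Fmap → ℤ
  | V => 0
  | I m0 _ => nv m0 + 1
  | L m0 Dim.zero _ _ => nv m0
  | L m0 Dim.one _ _ => nv m0 - 1

/-- Number of edges. -/
def ne : Fmap → ℤ
  | V => 0
  | I m0 _ => ne m0 + 1
  | L m0 Dim.zero _ _ => ne m0 - 1
  | L m0 Dim.one _ _ => ne m0

/-- Number of faces. -/
noncomputable def nf : Fmap → ℤ
  | V => 0
  | I m0 _ => nf m0 + 1
  | L m0 Dim.zero x y => if expf m0 (cA_1 m0 Dim.one x) y then nf m0 + 1 else nf m0 - 1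
  | L m0 Dim.one x y => if expf m0 x (cA m0 Dim.zero y) then nf m0 + 1 else nf m0 - 1

/-- Number of connected components. -/
noncomputable def nc : Fmap → ℤ
  | V => 0
  | I m0 _ => nc m0 + 1
  | L m0 _ x y => if eqc m0 x y then nc m0 else nc m0 - 1

/-- Euler characteristic. -/
noncomputable def ec (m : Fmap) : ℤ := nv m + ne m + nf m - nd m

/-- Genus. -/
noncomputable def genus (m : Fmap) : ℤ := nc m - ec m / 2

/-- Planarity. -/
def planar (m : Fmap) : Prop := genus m = 0

/-- Breaking the latest forward k-link of x. -/
def B : Fmap → Dim → Nat → Fmap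
  | V, _, _ => V
  | I m0 x0, k, x => I (B m0 k x) x0
  | L m0 k0 x0 y0, k, x =>
      if k = k0 ∧ x = x0 then m0 else L (B m0 k x) k0 x0 y0

/-- Breaking all the 0-links of the darts of a list, first one first. -/
def Bl (m : Fmap) : List (Nat × Bool) → Fmap
  | [] => m
  | (x, _) :: l0 => Bl (B m Dim.zero x) l0

/-- The dart representing the face coded by a double-link (x, b). -/
def faceDart (m : Fmap) : Nat × Bool → Nat
  | (x, b) => if b then A m Dim.zero x else bottom m Dim.zero x

/-- The edge of x is distinct from the edges of the darts of a list. -/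
def distinct_edge_list (m : Fmap) (x : Nat) : List (Nat × Bool) → Prop
  | [] => True
  | (x', _) :: l0 => distinct_edge_list m x l0 ∧ ¬ expe m x x'

/-- Ring condition (0): unicity of edges, and each dart 0-linked. -/
def pre_ring0 (m : Fmap) : List (Nat × Bool) → Prop
  | [] => True
  | (x, _) :: l0 => pre_ring0 m l0 ∧ distinct_edge_list m x l0 ∧ succd m Dim.zero x

/-- Adjacency of the faces coded by two double-links. -/
def adjacent_faces (m : Fmap) : Nat × Bool → Nat × Bool → Prop
  | (x, b), (x', b') =>
      let y := A m Dim.zero x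
      let y' := A m Dim.zero x'
      let x0 := bottom m Dim.zero x
      let x'0 := bottom m Dim.zero x'
      if b then (if b' then expf m x0 y' else expf m x0 x'0)
      else (if b' then expf m y y' else expf m y x'0)

/-- Ring condition (1): continuity. -/
def pre_ring1 (m : Fmap) : List (Nat × Bool) → Prop
  | [] => True
  | xb :: l0 =>
      pre_ring1 m l0 ∧
      match l0 with
      | [] => True
      | xb' :: _ => adjacent_faces m xb xb'

/-- Last element of a list of double-links (with default). -/
def lastd : List (Nat × Bool) → Nat × Bool
  | [] => (nil, true)
  | [a] => a
  | _ :: a :: l0 => lastd (a :: l0)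

/-- Ring condition (2): circularity. -/
def pre_ring2 (m : Fmap) : List (Nat × Bool) → Prop
  | [] => True
  | (x, b) :: l0 =>
      match l0 with
      | [] => expf m (A m Dim.zero x) (bottom m Dim.zero x)
      | _ :: _ => adjacent_faces m (lastd l0) (x, b)

/-- The faces coded by two double-links are distinct. -/
def distinct_faces (m : Fmap) (xb xb' : Nat × Bool) : Prop :=
  ¬ expf m (faceDart m xb) (faceDart m xb')

/-- The face of xb is distinct from the faces of a list. -/
def distinct_face_list (m : Fmap) (xb : Nat × Bool) : List (Nat × Bool) → Prop
  | [] => True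
  | xb' :: l0 => distinct_face_list m xb l0 ∧ distinct_faces m xb xb'

/-- Ring condition (3): simplicity. -/
def pre_ring3 (m : Fmap) : List (Nat × Bool) → Prop
  | [] => True
  | xb :: l0 => pre_ring3 m l0 ∧ distinct_face_list m xb l0

/-- A ring of faces. -/
def ring (m : Fmap) (l : List (Nat × Bool)) : Prop :=
  l ≠ [] ∧ pre_ring0 m l ∧ pre_ring1 m l ∧ pre_ring2 m l ∧ pre_ring3 m l

end Fmap

open Fmap

namespace JH

open Equiv Equiv.Perm

/-! ### Counting classes -/

def pair (a b : ℕ) : Setoid ℕ where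
  r u v := u = v ∨ (u = a ∧ v = b) ∨ (u = b ∧ v = a)
  iseqv := ⟨fun _ => Or.inl rfl, fun h => by grind, fun h h' => by grind⟩

def join (s : Setoid ℕ) (a b : ℕ) : Setoid ℕ where
  r u v := s u v ∨ (s u a ∧ s b v) ∨ (s u b ∧ s a v)
  iseqv := by
    have h1 := fun x => s.refl' x
    have h2 := fun {x y} (h : s x y) => s.symm' h
    have h3 := fun {x y z} (h : s x y) (h' : s y z) => s.trans' h h'
    refine ⟨fun x => Or.inl (h1 x), ?_, ?_⟩
    · rintro x y (h | ⟨h, h'⟩ | ⟨h, h'⟩)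
      · exact Or.inl (h2 h)
      · exact Or.inr (Or.inr ⟨h2 h', h2 h⟩)
      · exact Or.inr (Or.inl ⟨h2 h', h2 h⟩)
    · rintro x y z (h | ⟨h, h'⟩ | ⟨h, h'⟩) (k | ⟨k, k'⟩ | ⟨k, k'⟩)
      · exact Or.inl (h3 h k)
      · exact Or.inr (Or.inl ⟨h3 h k, k'⟩)
      · exact Or.inr (Or.inr ⟨h3 h k, k'⟩)
      · exact Or.inr (Or.inl ⟨h, h3 h' k⟩)
      · exact Or.inr (Or.inl ⟨h, k'⟩)
      · exact Or.inl (h3 h k')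
      · exact Or.inr (Or.inr ⟨h, h3 h' k⟩)
      · exact Or.inl (h3 h k')
      · exact Or.inr (Or.inr ⟨h, k'⟩)

theorem join_rel (s : Setoid ℕ) (a b u v : ℕ) :
    (join s a b) u v ↔ s u v ∨ (s u a ∧ s b v) ∨ (s u b ∧ s a v) := Iff.rfl

theorem join_eq (s : Setoid ℕ) (a b : ℕ) : join s a b = s ⊔ pair a b := by
  apply le_antisymm
  · intro u v h
    have hs : s ≤ s ⊔ pair a b := le_sup_left
    have hp : pair a b ≤ s ⊔ pair a b := le_sup_right
    have hab : (s ⊔ pair a b) a b := hp (Or.inr (Or.inl ⟨rfl, rfl⟩))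
    rcases h with h | ⟨h, h'⟩ | ⟨h, h'⟩
    · exact hs h
    · exact Setoid.trans' _ (hs h) (Setoid.trans' _ hab (hs h'))
    · exact Setoid.trans' _ (hs h) (Setoid.trans' _ (Setoid.symm' _ hab) (hs h'))
  · apply sup_le
    · intro u v h
      exact Or.inl h
    · rintro u v (h | ⟨rfl, rfl⟩ | ⟨rfl, rfl⟩)
      · subst h; exact Or.inl (s.refl' _)
      · exact Or.inr (Or.inl ⟨s.refl' _, s.refl' _⟩)
      · exact Or.inr (Or.inr ⟨s.refl' _, s.refl' _⟩)

theorem join_comm (s : Setoid ℕ) (a b c d : ℕ) :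
    join (join s a b) c d = join (join s c d) a b := by
  simp only [join_eq, sup_assoc, sup_comm (pair a b)]

theorem join_self (s : Setoid ℕ) (a b : ℕ) (h : s a b) : join s a b = s := by
  rw [join_eq, sup_eq_left]
  rintro u v (h' | ⟨rfl, rfl⟩ | ⟨rfl, rfl⟩)
  · subst h'; exact s.refl' _
  · exact h
  · exact s.symm' h

noncomputable def N (s : Setoid ℕ) (D : Finset ℕ) : ℕ :=
  (D.image (Quotient.mk s)).card

theorem N_insert (s : Setoid ℕ) (D : Finset ℕ) (x : ℕ) (h : ∀ t ∈ D, ¬ s x t) :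
    N s (insert x D) = N s D + 1 := by
  unfold N
  rw [Finset.image_insert, Finset.card_insert_of_notMem]
  intro hx
  obtain ⟨t, ht, hxt⟩ := Finset.mem_image.1 hx
  exact h t ht (s.symm' (Quotient.exact hxt))

theorem N_join (s : Setoid ℕ) (D : Finset ℕ) (a b : ℕ) (ha : a ∈ D) (hb : b ∈ D)
    (h : ¬ s a b) : N (join s a b) D + 1 = N s D := by
  have h1 := fun x => s.refl' x
  have h2 := fun {x y} (h : s x y) => s.symm' h
  have h3 := fun {x y z} (h : s x y) (h' : s y z) => s.trans' h h'
  unfold N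
  have hbm : (Quotient.mk s b) ∈ D.image (Quotient.mk s) := Finset.mem_image_of_mem _ hb
  rw [← Finset.card_erase_add_one hbm]
  congr 1
  symm
  let φ : Quotient s → Quotient (join s a b) :=
    Quotient.map' id (fun u v (huv : s u v) => (Or.inl huv : (join s a b) u v))
  apply Finset.card_bij (fun q _ => φ q)
  · intro q hq
    obtain ⟨t, ht, rfl⟩ := Finset.mem_image.1 (Finset.mem_of_mem_erase hq)
    exact Finset.mem_image_of_mem _ ht
  · intro q hq q' hq' he
    have nq := Finset.ne_of_mem_erase hq
    have nq' := Finset.ne_of_mem_erase hq'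
    obtain ⟨t, ht, rfl⟩ := Finset.mem_image.1 (Finset.mem_of_mem_erase hq)
    obtain ⟨t', ht', rfl⟩ := Finset.mem_image.1 (Finset.mem_of_mem_erase hq')
    have he' : (join s a b) t t' := Quotient.exact he
    apply Quotient.sound
    rcases he' with k | ⟨k, k'⟩ | ⟨k, k'⟩
    · exact k
    · exact absurd (Quotient.sound (h2 k')) nq'
    · exact absurd (Quotient.sound k) nq
  · intro q hq
    obtain ⟨t, ht, rfl⟩ := Finset.mem_image.1 hq
    by_cases htb : s t b
    · refine ⟨Quotient.mk s a, Finset.mem_erase.2 ⟨fun e => h (Quotient.exact e),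
        Finset.mem_image_of_mem _ ha⟩, ?_⟩
      exact Quotient.sound (show (join s a b) a t from Or.inr (Or.inl ⟨h1 a, h2 htb⟩))
    · exact ⟨Quotient.mk s t, Finset.mem_erase.2 ⟨fun e => htb (Quotient.exact e),
        Finset.mem_image_of_mem _ ht⟩, rfl⟩

/-! ### Cycles of permutations -/

def SC (f : Perm ℕ) : Setoid ℕ := SameCycle.setoid f

theorem SC_iff (f : Perm ℕ) (a b : ℕ) : (SC f) a b ↔ f.SameCycle a b := Iff.rfl

theorem SC_le (f : Perm ℕ) (s : Setoid ℕ) (h : ∀ z, s z (f z)) : SC f ≤ s := by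
  have hn : ∀ (n : ℕ) z, s z ((f ^ n) z) := by
    intro n
    induction n with
    | zero => intro z; exact s.refl' _
    | succ n ih =>
      intro z
      rw [pow_succ', Perm.mul_apply]
      exact s.trans' (ih z) (h _)
  rintro a b ⟨i, rfl⟩
  obtain ⟨n, rfl | rfl⟩ := i.eq_nat_or_neg
  · rw [zpow_natCast]; exact hn n a
  · have := hn n ((f ^ (-(n : ℤ))) a)
    apply s.symm'
    simpa using this

theorem SC_mul_swap_le (f : Perm ℕ) (a b : ℕ) : SC (f * swap a b) ≤ join (SC f) a b := by
  apply SC_le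
  intro z
  have hf : ∀ w, (SC f) w (f w) := fun w => ⟨1, by simp⟩
  rw [Perm.mul_apply]
  by_cases hza : z = a
  · subst hza
    rw [swap_apply_left]
    exact Or.inr (Or.inl ⟨(SC f).refl' _, hf _⟩)
  · by_cases hzb : z = b
    · subst hzb
      rw [swap_apply_right]
      exact Or.inr (Or.inr ⟨(SC f).refl' _, hf _⟩)
    · rw [swap_apply_of_ne_of_ne hza hzb]
      exact Or.inl (hf _)

theorem SC_join (f : Perm ℕ) (a b : ℕ) :
    join (SC (f * swap a b)) a b = join (SC f) a b := by
  have key : ∀ g : Perm ℕ, join (SC (g * swap a b)) a b ≤ join (SC g) a b := by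
    intro g
    rw [join_eq]
    refine sup_le (SC_mul_swap_le g a b) ?_
    rw [join_eq]; exact le_sup_right
  apply le_antisymm (key f)
  have := key (f * swap a b)
  rwa [mul_assoc, swap_mul_self, mul_one] at this

theorem periodic (f : Perm ℕ) (D : Finset ℕ) (hD : ∀ z, z ∉ D → f z = z) (a : ℕ) :
    ∃ p : ℕ, 0 < p ∧ (f ^ p) a = a := by
  by_cases ha : a ∈ D
  · have hmem : ∀ n : ℕ, (f ^ n) a ∈ (D : Set ℕ) := by
      intro n
      induction n with
      | zero => simpa using ha
      | succ n ih =>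
        rw [pow_succ', Perm.mul_apply]
        by_contra hc
        have := hD _ hc
        have := f.injective this
        rw [this] at hc
        exact hc ih
    obtain ⟨i, j, hij, h⟩ := (D.finite_toSet).exists_lt_map_eq_of_forall_mem hmem
    refine ⟨j - i, by omega, ?_⟩
    apply (f ^ i).injective
    rw [← Perm.mul_apply, ← pow_add, h]
    congr 2; omega
  · exact ⟨1, one_pos, by simpa using hD a ha⟩

theorem SC_nat (f : Perm ℕ) (D : Finset ℕ) (hD : ∀ z, z ∉ D → f z = z) (a b : ℕ) :
    (SC f) a b ↔ ∃ n : ℕ, (f ^ n) a = b := by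
  constructor
  · rintro ⟨i, rfl⟩
    obtain ⟨p, hp, hpa⟩ := periodic f D hD a
    refine ⟨(i % p).toNat, ?_⟩
    have hz : ((i % p).toNat : ℤ) = i % p := Int.toNat_of_nonneg (Int.emod_nonneg _ (by omega))
    rw [← zpow_natCast, hz]
    conv_rhs => rw [← Int.emod_add_mul_ediv i p, zpow_add, Perm.mul_apply, zpow_mul, zpow_natCast,
      zpow_apply_eq_self_of_apply_eq_self hpa]
  · rintro ⟨n, rfl⟩
    exact ⟨n, by simp⟩

theorem follow (f : Perm ℕ) (a b : ℕ) (n : ℕ)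
    (h : ∀ i, 0 < i → i < n → (f ^ i) b ≠ a ∧ (f ^ i) b ≠ b) :
    ∀ i, 0 < i → i ≤ n → ((f * swap a b) ^ i) a = (f ^ i) b := by
  intro i hi
  induction i, hi using Nat.le_induction with
  | base => intro _; simp
  | succ i hi ih =>
    intro hin
    rw [pow_succ', Perm.mul_apply, ih (by omega), Perm.mul_apply,
      swap_apply_of_ne_of_ne (h i hi (by omega)).1 (h i hi (by omega)).2, pow_succ',
      Perm.mul_apply]

theorem flip1 (f : Perm ℕ) (D : Finset ℕ) (hD : ∀ z, z ∉ D → f z = z) (a b : ℕ)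
    (h : ¬ (SC f) a b) : (SC (f * swap a b)) a b := by
  have hex := periodic f D hD b
  classical
  obtain ⟨hp, hpb⟩ := Nat.find_spec hex
  set n := Nat.find hex
  refine ⟨n, ?_⟩
  rw [zpow_natCast, follow f a b n _ n hp le_rfl, hpb]
  intro i hi hin
  refine ⟨fun e => h ((SC f).symm' ⟨i, by simpa using e⟩), fun e => ?_⟩
  exact Nat.find_min hex hin ⟨hi, e⟩

theorem flip2 (f : Perm ℕ) (D : Finset ℕ) (hD : ∀ z, z ∉ D → f z = z) (a b : ℕ)
    (hab : a ≠ b) (ha : a ∈ D) (hb : b ∈ D)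
    (h : (SC f) a b) : ¬ (SC (f * swap a b)) a b := by
  have hex : ∃ n : ℕ, (f ^ n) b = a := (SC_nat f D hD b a).1 ((SC f).symm' h)
  have hD' : ∀ z, z ∉ D → (f * swap a b) z = z := by
    intro z hz
    rw [Perm.mul_apply, swap_apply_of_ne_of_ne (by grind) (by grind), hD z hz]
  classical
  have hn := Nat.find_spec hex
  have hmin := fun {m} => Nat.find_min hex (m := m)
  set n := Nat.find hex
  have hn0 : 0 < n := by
    rcases Nat.eq_zero_or_pos n with h0 | h0
    · rw [h0] at hn; simp at hn; exact absurd hn.symm hab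
    · exact h0
  have hnb : ∀ i, 0 < i → i ≤ n → (f ^ i) b ≠ b := by
    intro i hi hin e
    apply hmin (m := n - i) (by omega)
    rw [← hn]
    conv_lhs => rw [← e]
    rw [← Perm.mul_apply, ← pow_add]
    congr 2; omega
  have hfol := follow f a b n (fun i hi hin => ⟨hmin hin, hnb i hi hin.le⟩)
  have hall : ∀ k : ℕ, ∃ i, 0 < i ∧ i ≤ n ∧ ((f * swap a b) ^ k) a = (f ^ i) b := by
    intro k
    induction k with
    | zero => exact ⟨n, hn0, le_rfl, by simp [hn]⟩
    | succ k ih =>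
      obtain ⟨i, hi, hin, e⟩ := ih
      rw [pow_succ', Perm.mul_apply, e]
      rcases Nat.lt_or_ge i n with hlt | hge
      · refine ⟨i + 1, by omega, hlt, ?_⟩
        rw [Perm.mul_apply, swap_apply_of_ne_of_ne (hmin hlt) (hnb i hi hin), pow_succ',
          Perm.mul_apply]
      · have : i = n := le_antisymm hin hge
        subst this
        exact ⟨1, one_pos, hn0, by rw [hn]; simp⟩
  intro hc
  obtain ⟨k, hk⟩ := (SC_nat _ D hD' a b).1 hc
  obtain ⟨i, hi, hin, e⟩ := hall k
  exact hnb i hi hin (e.symm.trans hk)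

theorem N_swap (f : Perm ℕ) (D : Finset ℕ) (hD : ∀ z, z ∉ D → f z = z) (a b : ℕ)
    (hab : a ≠ b) (ha : a ∈ D) (hb : b ∈ D) :
    (N (SC (f * swap a b)) D : ℤ) = if (SC f) a b then (N (SC f) D : ℤ) + 1
      else (N (SC f) D : ℤ) - 1 := by
  have hj := SC_join f a b
  split_ifs with h
  · have h' := flip2 f D hD a b hab ha hb h
    rw [join_self _ _ _ h] at hj
    have := N_join _ D a b ha hb h'
    rw [hj] at this
    omega
  · have h' := flip1 f D hD a b h
    rw [join_self _ _ _ h'] at hj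
    have := N_join _ D a b ha hb h
    rw [← hj] at this
    omega

/-! ### Hypermaps -/

def D : Fmap → Finset ℕ
  | V => ∅
  | I m x => insert x (D m)
  | L m _ _ _ => D m

def P : Fmap → Dim → Perm ℕ
  | V, _ => 1
  | I m _, k => P m k
  | L m k0 x y, k => if k = k0 then swap (P m k x) y * P m k else P m k

def E : Fmap → Setoid ℕ
  | V => ⊥
  | I m _ => E m
  | L m _ x y => join (E m) x y

theorem mem_D (m : Fmap) (z : ℕ) : z ∈ D m ↔ exd m z := by
  induction m with
  | V => simp [D, exd]
  | I m x ih => simp [D, exd, ih]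
  | L m k x y ih => simp [D, exd, ih]

theorem exd_ne (m : Fmap) (h : inv_hmap m) (z : ℕ) (hz : exd m z) : z ≠ nil := by
  induction m with
  | V => exact hz.elim
  | I m x ih =>
    rcases hz with rfl | hz
    · exact h.2.1
    · exact ih h.1 hz
  | L m k x y ih => exact ih h.1 hz

theorem P_fix (m : Fmap) (h : inv_hmap m) (k : Dim) (z : ℕ) (hz : ¬ exd m z) : P m k z = z := by
  induction m with
  | V => rfl
  | I m x ih => exact ih h.1 (fun e => hz (Or.inr e))
  | L m k0 x y ih =>
    have e := ih h.1 hz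
    obtain ⟨hi, hx, hy, -⟩ := h
    simp only [P]
    split_ifs
    · rw [Perm.mul_apply, e, swap_apply_of_ne_of_ne]
      · intro h'
        rw [← e] at h'
        have := (P m k).injective h'
        subst this; exact hz hx
      · rintro rfl; exact hz hy
    · exact e

theorem exd_P (m : Fmap) (h : inv_hmap m) (k : Dim) (z : ℕ) : exd m (P m k z) ↔ exd m z := by
  constructor
  · intro h1
    by_contra hc
    rw [P_fix m h k z hc] at h1
    exact hc h1
  · intro h1
    by_contra hc
    have := P_fix m h k _ hc
    have := (P m k).injective this
    rw [this] at hc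
    exact hc h1

theorem exd_Pinv (m : Fmap) (h : inv_hmap m) (k : Dim) (z : ℕ) :
    exd m ((P m k)⁻¹ z) ↔ exd m z := by
  rw [← exd_P m h k]; simp

theorem bottom_eq (m : Fmap) (h : inv_hmap m) (k : Dim) (z : ℕ) (hz : exd m z)
    (hs : ¬ succd m k z) : bottom m k z = P m k z := by
  induction m generalizing z with
  | V => exact hz.elim
  | I m x ih =>
    simp only [bottom, P]
    split_ifs with hzx
    · subst hzx; exact (P_fix m h.1 k _ h.2.2).symm
    · exact ih h.1 z (hz.resolve_left hzx) hs
  | L m k0 x y ih =>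
    have hy := exd_ne m h.1 y h.2.2.1
    obtain ⟨hi, hx, hye, hsx, hpy, hc⟩ := h
    simp only [bottom, P]
    simp only [succd, A] at hs
    by_cases hk : k = k0
    · subst hk
      simp only [if_true] at hs ⊢
      by_cases hzx : z = x
      · simp [hzx, hy] at hs
      · rw [if_neg hzx] at hs
        rw [ih hi z hz hs, ih hi x hx hsx, Perm.mul_apply, swap_apply_def,
          if_neg (fun e => hzx ((P m k).injective e))]
    · simp only [if_neg hk] at hs ⊢
      exact ih hi z hz hs

theorem top_eq (m : Fmap) (h : inv_hmap m) (k : Dim) (z : ℕ) (hz : exd m z)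
    (hs : ¬ predd m k z) : top m k z = (P m k)⁻¹ z := by
  induction m generalizing z with
  | V => exact hz.elim
  | I m x ih =>
    simp only [top, P]
    split_ifs with hzx
    · subst hzx
      rw [Perm.eq_inv_iff_eq]
      exact (P_fix m h.1 k _ h.2.2)
    · exact ih h.1 z (hz.resolve_left hzx) hs
  | L m k0 x y ih =>
    have hx0 := exd_ne m h.1 x h.2.1
    obtain ⟨hi, hx, hye, hsx, hpy, hc⟩ := h
    simp only [top, P]
    simp only [predd, A_1] at hs
    by_cases hk : k = k0
    · subst hk
      simp only [if_true] at hs ⊢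
      by_cases hzx : z = y
      · simp [hzx, hx0] at hs
      · rw [if_neg hzx] at hs
        rw [ih hi z hz hs, ih hi y hye hpy, mul_inv_rev, Perm.mul_apply, swap_inv, swap_apply_def,
          if_neg hzx]
        simp only [Perm.inv_eq_iff_eq]
        split_ifs <;> rfl
    · simp only [if_neg hk] at hs ⊢
      exact ih hi z hz hs

theorem cA_eq (m : Fmap) (h : inv_hmap m) (k : Dim) (z : ℕ) (hz : exd m z) :
    cA m k z = P m k z := by
  induction m generalizing z with
  | V => exact hz.elim
  | I m x ih =>
    simp only [cA, P]
    split_ifs with hzx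
    · subst hzx; exact (P_fix m h.1 k _ h.2.2).symm
    · exact ih h.1 z (hz.resolve_left hzx)
  | L m k0 x y ih =>
    obtain ⟨hi, hx, hye, hsx, hpy, hc⟩ := h
    simp only [cA, P]
    by_cases hk : k = k0
    · subst hk
      simp only [if_true]
      rw [top_eq m hi k y hye hpy, bottom_eq m hi k x hx hsx, ih hi z hz, Perm.mul_apply,
        swap_apply_def]
      simp only [Perm.eq_inv_iff_eq, EmbeddingLike.apply_eq_iff_eq]
    · simp only [if_neg hk]
      exact ih hi z hz

theorem cA_1_eq (m : Fmap) (h : inv_hmap m) (k : Dim) (z : ℕ) (hz : exd m z) :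
    cA_1 m k z = (P m k)⁻¹ z := by
  induction m generalizing z with
  | V => exact hz.elim
  | I m x ih =>
    simp only [cA_1, P]
    split_ifs with hzx
    · subst hzx
      rw [Perm.eq_inv_iff_eq]
      exact (P_fix m h.1 k _ h.2.2)
    · exact ih h.1 z (hz.resolve_left hzx)
  | L m k0 x y ih =>
    obtain ⟨hi, hx, hye, hsx, hpy, hc⟩ := h
    rw [cA_eq m hi k0 x hx] at hc
    simp only [cA_1, P]
    by_cases hk : k = k0
    · subst hk
      simp only [if_true]
      rw [top_eq m hi k y hye hpy, bottom_eq m hi k x hx hsx, ih hi z hz, mul_inv_rev,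
        Perm.mul_apply, swap_inv, swap_apply_def]
      by_cases h1 : z = y
      · subst h1; rw [if_pos rfl, if_neg (Ne.symm hc), if_pos rfl]; simp
      · rw [if_neg h1, if_neg h1]
        split_ifs <;> rfl
    · simp only [if_neg hk]
      exact ih hi z hz

def F (m : Fmap) : Perm ℕ := (P m Dim.one)⁻¹ * (P m Dim.zero)⁻¹

theorem cF_eq (m : Fmap) (h : inv_hmap m) (z : ℕ) (hz : exd m z) : cF m z = F m z := by
  unfold cF F
  rw [cA_1_eq m h _ z hz, cA_1_eq m h _ _ ((exd_Pinv m h _ z).2 hz), Perm.mul_apply]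

theorem exd_F (m : Fmap) (h : inv_hmap m) (z : ℕ) : exd m (F m z) ↔ exd m z := by
  unfold F
  rw [Perm.mul_apply, exd_Pinv m h, exd_Pinv m h]

theorem F_fix (m : Fmap) (h : inv_hmap m) (z : ℕ) (hz : z ∉ D m) : F m z = z := by
  rw [mem_D] at hz
  unfold F
  rw [Perm.mul_apply, Perm.inv_eq_iff_eq, Perm.inv_eq_iff_eq, P_fix m h _ z hz, P_fix m h _ z hz]

theorem cF_iter (m : Fmap) (h : inv_hmap m) (z : ℕ) (hz : exd m z) (n : ℕ) :
    (cF m)^[n] z = (F m ^ n) z ∧ exd m ((F m ^ n) z) := by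
  induction n with
  | zero => simpa using hz
  | succ n ih =>
    rw [Function.iterate_succ_apply', ih.1, cF_eq m h _ ih.2, pow_succ', Perm.mul_apply]
    exact ⟨rfl, (exd_F m h _).2 ih.2⟩

theorem expf_iff (m : Fmap) (h : inv_hmap m) (z t : ℕ) (hz : exd m z) :
    expf m z t ↔ (SC (F m)) z t := by
  rw [SC_nat (F m) (D m) (F_fix m h)]
  unfold expf
  simp only [hz, true_and]
  exact exists_congr (fun n => by rw [(cF_iter m h z hz n).1])

theorem E_exd (m : Fmap) (h : inv_hmap m) (z t : ℕ) (he : (E m) z t) :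
    z = t ∨ (exd m z ∧ exd m t) := by
  induction m generalizing z t with
  | V => exact Or.inl he
  | I m x ih =>
    rcases ih h.1 z t he with h' | ⟨h1, h2⟩
    · exact Or.inl h'
    · exact Or.inr ⟨Or.inr h1, Or.inr h2⟩
  | L m k x y ih =>
    obtain ⟨hi, hx, hy, -⟩ := h
    simp only [exd]
    rcases he with he | ⟨h1, h2⟩ | ⟨h1, h2⟩
    · exact ih hi z t he
    · have a := ih hi _ _ h1
      have b := ih hi _ _ h2
      grind
    · have a := ih hi _ _ h1
      have b := ih hi _ _ h2
      grind

theorem E_I (m : Fmap) (x z t : ℕ) : (E (I m x)) z t ↔ (E m) z t := Iff.rfl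

theorem E_L (m : Fmap) (k : Dim) (x y z t : ℕ) : (E (L m k x y)) z t ↔
    (E m) z t ∨ ((E m) z x ∧ (E m) y t) ∨ ((E m) z y ∧ (E m) x t) := Iff.rfl

theorem eqc_iff (m : Fmap) (h : inv_hmap m) (z t : ℕ) :
    eqc m z t ↔ exd m z ∧ exd m t ∧ (E m) z t := by
  induction m generalizing z t with
  | V => simp [eqc, exd]
  | I m x ih =>
    simp only [eqc, exd, E_I, ih h.1]
    have hx := h.2.2
    have h0 := E_exd m h.1
    have hr := (E m).refl'
    constructor
    · rintro (⟨rfl, rfl⟩ | ⟨h1, h2, h3⟩)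
      · exact ⟨Or.inl rfl, Or.inl rfl, hr _⟩
      · exact ⟨Or.inr h1, Or.inr h2, h3⟩
    · rintro ⟨h1, h2, h3⟩
      have := h0 _ _ h3
      grind
  | L m k x y ih =>
    obtain ⟨hi, hx, hy, -⟩ := h
    simp only [eqc, exd, E_L, ih hi]
    grind

theorem nc_eq (m : Fmap) (h : inv_hmap m) : nc m = N (E m) (D m) := by
  induction m with
  | V => simp [nc, N, D]
  | I m x ih =>
    simp only [nc, D, E]
    rw [N_insert, ih h.1]
    · push_cast; rfl
    · intro t ht hxt
      rw [mem_D] at ht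
      have := E_exd m h.1 _ _ hxt
      have := h.2.2
      grind
  | L m k x y ih =>
    have hi := h.1
    have hx := h.2.1
    have hy := h.2.2.1
    simp only [nc, D, E]
    rw [eqc_iff m hi]
    simp only [hx, hy, true_and]
    rw [ih hi]
    split_ifs with he
    · rw [join_self _ _ _ he]
    · have := N_join (E m) (D m) x y ((mem_D _ _).2 hx) ((mem_D _ _).2 hy) he
      omega

theorem F_L0 (m : Fmap) (x y : ℕ) :
    F (L m Dim.zero x y) = F m * swap (P m Dim.zero x) y := by
  simp [F, P, mul_assoc]

theorem F_L1 (m : Fmap) (x y : ℕ) :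
    F (L m Dim.one x y) = F m * swap (P m Dim.zero (P m Dim.one x)) (P m Dim.zero y) := by
  simp only [F, P, if_true, reduceCtorEq, if_false, mul_inv_rev, swap_inv, swap_apply_apply]
  group

theorem SC_step (f : Perm ℕ) (a b : ℕ) : (SC f) (f a) b ↔ (SC f) a b :=
  sameCycle_apply_left

theorem nf_eq (m : Fmap) (h : inv_hmap m) : nf m = N (SC (F m)) (D m) := by
  induction m with
  | V => simp [nf, N, D]
  | I m x ih =>
    have hF : F (I m x) = F m := rfl
    simp only [nf, D, hF]
    rw [N_insert, ih h.1]
    · push_cast; rfl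
    · intro t ht hxt
      have hx : x ∉ D m := by rw [mem_D]; exact h.2.2
      obtain ⟨n, hn⟩ := (SC_nat _ _ (F_fix m h.1) _ _).1 hxt
      have : (F m ^ n) x = x := Perm.pow_apply_eq_self_of_apply_eq_self (F_fix m h.1 x hx) n
      rw [this] at hn
      subst hn; exact hx ht
  | L m k x y ih =>
    obtain ⟨hi, hx, hy, hsx, hpy, hc⟩ := h
    rw [cA_eq m hi k x hx] at hc
    cases k with
    | zero =>
      simp only [nf, D]
      rw [F_L0, N_swap (F m) (D m) (F_fix m hi) _ _ hc, ← ih hi,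
        cA_1_eq m hi _ x hx, expf_iff m hi _ _ ((exd_Pinv m hi _ x).2 hx), ← SC_step _ (P m _ x)]
      · simp [F]
      · rw [mem_D, exd_P m hi]; exact hx
      · rw [mem_D]; exact hy
    | one =>
      simp only [nf, D]
      rw [F_L1, N_swap (F m) (D m) (F_fix m hi) _ _ (fun e => hc ((P m _).injective e)), ← ih hi,
        cA_eq m hi _ y hy, expf_iff m hi _ _ hx, ← SC_step _ (P m _ (P m _ x))]
      · simp [F]
      · rw [mem_D, exd_P m hi, exd_P m hi]; exact hx
      · rw [mem_D, exd_P m hi]; exact hy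

theorem E_P (m : Fmap) (k : Dim) (z : ℕ) : (E m) z (P m k z) := by
  induction m generalizing z with
  | V => rfl
  | I m x ih => exact ih z
  | L m k0 x y ih =>
    rw [E_L]
    simp only [P]
    split_ifs
    · rw [Perm.mul_apply, swap_apply_def]
      split_ifs with h1 h2
      · have := (P m k).injective h1
        subst this
        exact Or.inr (Or.inl ⟨(E m).refl' _, (E m).refl' _⟩)
      · exact Or.inr (Or.inr ⟨h2 ▸ ih z, ih x⟩)
      · exact Or.inl (ih z)
    · exact Or.inl (ih z)

theorem E_Pinv (m : Fmap) (k : Dim) (z : ℕ) : (E m) z ((P m k)⁻¹ z) := by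
  have := E_P m k ((P m k)⁻¹ z)
  have h2 : P m k ((P m k)⁻¹ z) = z := by simp
  rw [h2] at this
  exact (E m).symm' this

theorem SC_E (m : Fmap) : SC (F m) ≤ E m := by
  apply SC_le
  intro z
  unfold F
  rw [Perm.mul_apply]
  exact (E m).trans' (E_Pinv m _ z) (E_Pinv m _ _)

theorem genus_nonneg (m : Fmap) (h : inv_hmap m) : ec m ≤ 2 * nc m := by
  unfold ec
  induction m with
  | V => simp [nv, ne, nf, nd, nc]
  | I m x ih =>
    have := ih h.1
    simp only [nv, ne, nf, nd, nc]
    omega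
  | L m k x y ih =>
    have := ih h.1
    obtain ⟨hi, hx, hy, hsx, hpy, hc⟩ := h
    cases k with
    | zero =>
      have key : expf m (cA_1 m Dim.one x) y → eqc m x y := by
        rw [cA_1_eq m hi _ x hx, expf_iff m hi _ _ ((exd_Pinv m hi _ x).2 hx), eqc_iff m hi]
        exact fun e => ⟨hx, hy, (E m).trans' (E_Pinv m _ x) (SC_E m e)⟩
      simp only [nv, ne, nf, nd, nc]
      split_ifs <;> first | omega | (exfalso; tauto)
    | one =>
      have key : expf m x (cA m Dim.zero y) → eqc m x y := by
        rw [cA_eq m hi _ y hy, expf_iff m hi _ _ hx, eqc_iff m hi]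
        exact fun e => ⟨hx, hy, (E m).trans' (SC_E m e) ((E m).symm' (E_P m _ y))⟩
      simp only [nv, ne, nf, nd, nc]
      split_ifs <;> first | omega | (exfalso; tauto)

/-! ### Breaking -/

theorem succd_exd (m : Fmap) (h : inv_hmap m) (k : Dim) (x : ℕ) (hs : succd m k x) :
    exd m x ∧ exd m (A m k x) ∧ predd m k (A m k x) := by
  induction m with
  | V => exact absurd rfl hs
  | I m x0 ih =>
    obtain ⟨a, b, c⟩ := ih h.1 hs
    exact ⟨Or.inr a, Or.inr b, c⟩
  | L m k0 x0 y0 ih =>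
    have hx0 := exd_ne m h.1 x0 h.2.1
    obtain ⟨hi, hx, hye, hsx, hpy, hc⟩ := h
    simp only [succd, predd, exd, A, A_1] at *
    grind

theorem swap_lemma (Q : Perm ℕ) (x y x0 y0 : ℕ) (hx : x ≠ x0) (hy : y ≠ y0) :
    swap ((swap (Q x) y * Q) x0) y0 * (swap (Q x) y * Q) =
      swap ((swap (Q x0) y0 * Q) x) y * (swap (Q x0) y0 * Q) := by
  have hne : Q x ≠ Q x0 := fun e => hx (Q.injective e)
  ext z
  simp only [Perm.mul_apply]
  generalize Q x = a at *
  generalize Q x0 = c at *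
  generalize Q z = w
  simp only [swap_apply_def]
  grind

theorem break_main (m : Fmap) (h : inv_hmap m) (k : Dim) (x : ℕ) (hs : succd m k x) :
    inv_hmap (B m k x) ∧ (∀ z, exd (B m k x) z ↔ exd m z) ∧
    (∀ k' z, succd (B m k x) k' z → succd m k' z) ∧
    (∀ k' z, predd (B m k x) k' z → predd m k' z) ∧
    (∀ k', k' ≠ k → P m k' = P (B m k x) k') ∧
    P m k = swap (P (B m k x) k x) (A m k x) * P (B m k x) k ∧
    P (B m k x) k x ≠ A m k x ∧
    bottom m k x = P (B m k x) k x ∧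
    E m = join (E (B m k x)) x (A m k x) := by
  induction m with
  | V => exact absurd rfl hs
  | I m x0 ih =>
    obtain ⟨i1, i2, i3, i4, i5, i6, i7, i8, i9⟩ := ih h.1 hs
    have hx := (succd_exd m h.1 k x hs).1
    refine ⟨⟨i1, h.2.1, fun e => h.2.2 ((i2 _).1 e)⟩, ?_, i3, i4, i5, i6, i7, ?_, i9⟩
    · intro z; simp only [B, exd, i2]
    · simp only [B, bottom]
      rw [if_neg]
      · exact i8
      · rintro rfl; exact h.2.2 hx
  | L m k0 x0 y0 ih =>
    have hx0 := exd_ne m h.1 x0 h.2.1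
    have hy0 := exd_ne m h.1 y0 h.2.2.1
    obtain ⟨hi, hx, hye, hsx, hpy, hc⟩ := h
    have hc' := hc
    rw [cA_eq m hi k0 x0 hx] at hc
    by_cases hb : k = k0 ∧ x = x0
    · obtain ⟨rfl, rfl⟩ := hb
      have hB : B (L m k x y0) k x = m := by simp [B]
      have hA : A (L m k x y0) k x = y0 := by simp [A]
      rw [hB, hA]
      refine ⟨hi, fun z => Iff.rfl, ?_, ?_, ?_, ?_, hc, ?_, rfl⟩
      · intro k' z; simp only [succd, A]; grind
      · intro k' z; simp only [predd, A_1]; grind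
      · intro k' hk'; simp [P, hk']
      · simp [P]
      · have := bottom_eq m hi k x hx hsx
        simp only [bottom, if_true, this]
        simp
    · have hB : B (L m k0 x0 y0) k x = L (B m k x) k0 x0 y0 := by simp [B, hb]
      have hA : A (L m k0 x0 y0) k x = A m k x := by
        simp only [A]; grind
      have hs' : succd m k x := by
        unfold succd at hs ⊢; rwa [hA] at hs
      obtain ⟨i1, i2, i3, i4, i5, i6, i7, i8, i9⟩ := ih hi hs'
      obtain ⟨ex, ey, py⟩ := succd_exd m hi k x hs'
      rw [hB, hA]
      have hx' := (i2 _).2 hx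
      have hy' := (i2 _).2 hye
      -- openness
      have hne : k = k0 → x ≠ x0 ∧ A m k x ≠ y0 := by
        rintro rfl
        refine ⟨fun e => hb ⟨rfl, e⟩, fun e => hpy (e ▸ py)⟩
      have hopen : P (B m k x) k0 x0 ≠ y0 := by
        by_cases hk : k0 = k
        · subst hk
          obtain ⟨n1, n2⟩ := hne rfl
          intro e
          apply hc
          rw [i6, Perm.mul_apply, e, swap_apply_of_ne_of_ne]
          · rw [← e]; exact fun e' => n1 ((P (B m k0 x) k0).injective e').symm
          · exact n2.symm
        · rw [← i5 k0 hk]; exact hc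
      refine ⟨⟨i1, hx', hy', fun e => hsx (i3 _ _ e), fun e => hpy (i4 _ _ e), ?_⟩,
        i2, ?_, ?_, ?_, ?_, ?_, ?_, ?_⟩
      · rw [cA_eq _ i1 _ _ hx']; exact hopen
      · intro k' z
        have := i3 k' z
        simp only [succd, A] at *
        grind
      · intro k' z
        have := i4 k' z
        simp only [predd, A_1] at *
        grind
      · intro k' hk'
        simp only [P]
        rw [i5 k' hk']
      · simp only [P]
        by_cases hk : k = k0
        · subst hk
          simp only [if_true]
          rw [i6]
          exact swap_lemma _ _ _ _ _ (hne rfl).1 (hne rfl).2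
        · simp only [if_neg hk]; exact i6
      · simp only [P]
        by_cases hk : k = k0
        · subst hk
          simp only [if_true]
          obtain ⟨n1, n2⟩ := hne rfl
          have n3 : P (B m k x) k x ≠ P (B m k x) k x0 := fun e => n1 ((P _ k).injective e)
          rw [i6] at hc
          simp only [Perm.mul_apply, swap_apply_def] at hc ⊢
          grind
        · simp only [if_neg hk]; exact i7
      · simp only [P, bottom]
        by_cases hk : k = k0
        · subst hk
          simp only [if_true]
          obtain ⟨n1, n2⟩ := hne rfl
          have n3 : P (B m k x) k x ≠ P (B m k x) k x0 := fun e => n1 ((P _ k).injective e)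
          have hbot := bottom_eq m hi k x0 hx hsx
          rw [i6] at hc hbot
          rw [i8, hbot]
          simp only [Perm.mul_apply, swap_apply_def] at hc ⊢
          grind
        · simp only [if_neg hk]; exact i8
      · simp only [E]
        rw [i9, join_comm]

theorem break_counts (m : Fmap) (x : ℕ) (hs : succd m Dim.zero x) :
    nd (B m Dim.zero x) = nd m ∧ nv (B m Dim.zero x) = nv m ∧
      ne (B m Dim.zero x) = ne m + 1 := by
  induction m with
  | V => exact absurd rfl hs
  | I m x0 ih =>
    obtain ⟨a, b, c⟩ := ih hs
    simp only [B, nd, nv, ne]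
    omega
  | L m k0 x0 y0 ih =>
    simp only [B]
    split_ifs with hb
    · obtain ⟨rfl, rfl⟩ := hb
      simp [nd, nv, ne]
    · have hs' : succd m Dim.zero x := by
        simp only [succd, A] at *; grind
      obtain ⟨a, b, c⟩ := ih hs'
      cases k0 <;> simp only [nd, nv, ne] <;> omega

end JH

open JH in
/-- Jordan theorem for a ring of length one. -/
theorem Jordan1 (m : Fmap) (x : Nat) (b : Bool)
    (h1 : inv_hmap m) (h2 : planar m) (h3 : ring m [(x, b)]) :
    nc (B m Dim.zero x) = nc m + 1 := by
  obtain ⟨-, ⟨-, -, hs⟩, -, hr, -⟩ := h3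
  change expf m (A m Dim.zero x) (bottom m Dim.zero x) at hr
  obtain ⟨i1, i2, i3, i4, i5, i6, i7, i8, i9⟩ := break_main m h1 Dim.zero x hs
  obtain ⟨ex, ey, py⟩ := succd_exd m h1 _ x hs
  obtain ⟨c1, c2, c3⟩ := break_counts m x hs
  have hD : D (B m Dim.zero x) = D m := by
    ext z; rw [mem_D, mem_D, i2]
  rw [expf_iff m h1 _ _ ey, i8] at hr
  have hF : F (B m Dim.zero x) = F m *
      Equiv.swap (P (B m Dim.zero x) Dim.zero x) (A m Dim.zero x) := by
    unfold F
    rw [i6, i5 Dim.one (by decide)]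
    simp [mul_assoc]
  have hnf : nf (B m Dim.zero x) = nf m + 1 := by
    rw [nf_eq _ i1, nf_eq m h1, hD, hF, N_swap (F m) (D m) (F_fix m h1) _ _ i7,
      if_pos (Setoid.symm' _ hr)]
    · rw [mem_D, ← i2, exd_P _ i1, i2]; exact ex
    · rw [mem_D]; exact ey
  have hnc : nc (B m Dim.zero x) ≤ nc m + 1 := by
    rw [nc_eq _ i1, nc_eq m h1, hD, i9]
    by_cases he : (E (B m Dim.zero x)) x (A m Dim.zero x)
    · rw [join_self _ _ _ he]; omega
    · have := N_join _ (D m) _ _ ((mem_D _ _).2 ex) ((mem_D _ _).2 ey) he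
      omega
  have hg := genus_nonneg _ i1
  unfold planar genus at h2
  unfold ec at h2 hg
  omega
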